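/- Let s ≥ 1/2. The Miura map M(v) = v_x + v^2 - P_0(v^2) is a bijection from the mean-zero Sobolev space H^s_0(T) onto H^{s-1}_0(T), and its inverse is locally Lipschitz from H^{s-1}_0(T) to H^s_0(T). -/

import Mathlib

/-! We represent mean-zero real functions on the circle `𝕋 = ℝ/2πℤ` by their sequences of
Fourier coefficients `a : ℤ → ℂ` (with `a 0 = 0` and the reality condition
`a (-k) = conj (a k)`).  The Sobolev space `H^s₀(𝕋)` corresponds to the weighted `ℓ²`
condition below, and the Miura transform `M v = v_x + v² - P₀(v²)` acts on Fourier
coefficients by `(M a) k = i k a k + (a ⋆ a) k` for `k ≠ 0`, and `(M a) 0 = 0`. -/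

/-- Square of the `H^s` norm summand; `hsNorm s a` is the `H^s(𝕋)` norm. -/
noncomputable def hsNorm (s : ℝ) (a : ℤ → ℂ) : ℝ :=
  Real.sqrt (∑' k : ℤ, (1 + (k : ℝ) ^ 2) ^ s * ‖a k‖ ^ 2)

/-- Membership in `H^s(𝕋)` (for Fourier coefficient sequences). -/
def InHs (s : ℝ) (a : ℤ → ℂ) : Prop :=
  Summable fun k : ℤ => (1 + (k : ℝ) ^ 2) ^ s * ‖a k‖ ^ 2

/-- The sequence is the Fourier transform of a real-valued function. -/
def IsRealSeq (a : ℤ → ℂ) : Prop := ∀ k, a (-k) = starRingEnd ℂ (a k)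

/-- Convolution of Fourier coefficient sequences (Fourier transform of the product). -/
noncomputable def seqConv (a b : ℤ → ℂ) (k : ℤ) : ℂ := ∑' j : ℤ, a j * b (k - j)

/-- The Miura transform `M v = v_x + v² - P₀(v²)` on the Fourier side. -/
noncomputable def miura (a : ℤ → ℂ) (k : ℤ) : ℂ :=
  if k = 0 then 0 else Complex.I * (k : ℂ) * a k + seqConv a a k

section QuadraticMaps

open Topology

variable {X : Type*} [NormedAddCommGroup X] [NormedSpace ℝ X]

theorem quadratic_sub (A : X →L[ℝ] X →L[ℝ] X) (hsymm : ∀ x y, A x y = A y x) (x y : X) :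
    (x + A x x) - (y + A y y) = (x - y) + A (x + y) (x - y) := by
  simp only [map_add, map_sub, add_apply]
  rw [hsymm y x]
  abel

variable [CompleteSpace X]

theorem isUnit_one_add_of_bounded_below (A : X →L[ℝ] X →L[ℝ] X)
    (hA : ∀ R : ℝ, ∃ C : ℝ, 0 < C ∧ ∀ q w : X, ‖q‖ ≤ R → ‖w‖ ≤ C * ‖w + A q w‖) (q : X) :
    IsUnit ((1 : X →L[ℝ] X) + A q) := by
  set S : Set X := {q | IsUnit ((1 : X →L[ℝ] X) + A q)} with hS
  have hopen : IsOpen S := by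
    have hc : Continuous fun q : X => (1 : X →L[ℝ] X) + A q := by fun_prop
    exact Units.isOpen.preimage hc
  have hclosed : IsClosed S := by
    refine isClosed_of_closure_subset fun p hp => ?_
    obtain ⟨C, hC, hb⟩ := hA (‖p‖ + 1)
    have hpos : 0 < min 1 (1 / (2 * C * (‖A‖ + 1))) := by positivity
    obtain ⟨p', hp', hd⟩ := Metric.mem_closure_iff.1 hp _ hpos
    obtain ⟨x, hx⟩ : IsUnit ((1 : X →L[ℝ] X) + A p') := hp'
    have hd1 : ‖p - p'‖ < 1 := by
      rw [← dist_eq_norm]; exact hd.trans_le (min_le_left _ _)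
    have hd2 : ‖p - p'‖ < 1 / (2 * C * (‖A‖ + 1)) := by
      rw [← dist_eq_norm]; exact hd.trans_le (min_le_right _ _)
    have hp'n : ‖p'‖ ≤ ‖p‖ + 1 := by
      have := norm_sub_norm_le p' p
      rw [norm_sub_rev] at this
      linarith
    have hinv : ‖(↑x⁻¹ : X →L[ℝ] X)‖ ≤ C := by
      refine ContinuousLinearMap.opNorm_le_bound _ hC.le fun y => ?_
      have h1 := hb p' ((↑x⁻¹ : X →L[ℝ] X) y) hp'n
      have h2 : (↑x : X →L[ℝ] X) ((↑x⁻¹ : X →L[ℝ] X) y) = y := by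
        rw [← mul_apply_eq_comp, Units.mul_inv, one_apply_eq_self]
      rw [hx] at h2
      change ((↑x⁻¹ : X →L[ℝ] X) y) + A p' ((↑x⁻¹ : X →L[ℝ] X) y) = y at h2
      rwa [h2] at h1
    rcases subsingleton_or_nontrivial X with hX | hX
    · have : (1 : X →L[ℝ] X) + A p = 1 := by
        ext y; exact Subsingleton.elim _ _
      change IsUnit _
      rw [this]
      exact isUnit_one
    have hinv_pos : 0 < ‖(↑x⁻¹ : X →L[ℝ] X)‖ := Units.norm_pos _
    have hlt : ‖((1 : X →L[ℝ] X) + A p) - x‖ < ‖(↑x⁻¹ : X →L[ℝ] X)‖⁻¹ := by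
      have h3 : ((1 : X →L[ℝ] X) + A p) - x = A (p - p') := by
        rw [hx, map_sub]; abel
      rw [h3]
      have h4 : ‖A (p - p')‖ ≤ ‖A‖ * ‖p - p'‖ := A.le_opNorm _
      have h5 : C⁻¹ ≤ ‖(↑x⁻¹ : X →L[ℝ] X)‖⁻¹ := inv_anti₀ hinv_pos hinv
      have h6 : ‖A‖ * ‖p - p'‖ < C⁻¹ := by
        have h7 : (‖A‖ + 1) * ‖p - p'‖ < (‖A‖ + 1) * (1 / (2 * C * (‖A‖ + 1))) := by gcongr
        have h8 : (‖A‖ + 1) * (1 / (2 * C * (‖A‖ + 1))) = C⁻¹ / 2 := by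
          have : ‖A‖ + 1 ≠ 0 := by positivity
          field_simp
        have h9 : 0 < C⁻¹ := by positivity
        nlinarith [norm_nonneg (p - p')]
      linarith
    exact ⟨Units.ofNearby x _ hlt, rfl⟩
  have : S = Set.univ := IsClopen.eq_univ ⟨hclosed, hopen⟩ ⟨0, by simp [hS]⟩
  exact (this ▸ Set.mem_univ q : q ∈ S)

theorem quadratic_surjective (A : X →L[ℝ] X →L[ℝ] X) (hsymm : ∀ x y, A x y = A y x)
    (hA : ∀ R : ℝ, ∃ C : ℝ, 0 < C ∧ ∀ q w : X, ‖q‖ ≤ R → ‖w‖ ≤ C * ‖w + A q w‖)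
    (hG : ∀ R : ℝ, ∃ F : ℝ, ∀ v : X, ‖v + A v v‖ ≤ R → ‖v‖ ≤ F) :
    Function.Surjective fun v : X => v + A v v := by
  set G : X → X := fun v => v + A v v with hGdef
  have hopen : IsOpen (Set.range G) := by
    refine isOpen_iff_mem_nhds.2 ?_
    rintro _ ⟨v, rfl⟩
    have hd : HasStrictFDerivAt G ((1 : X →L[ℝ] X) + A ((2 : ℝ) • v)) v := by
      have h1 : HasStrictFDerivAt (fun v : X => A v v)
          ((A v).comp (ContinuousLinearMap.id ℝ X) + A.flip v) v := by
        have := (A.hasStrictFDerivAt (x := v)).clm_apply (hasStrictFDerivAt_id v)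
        exact this
      have h2 := (hasStrictFDerivAt_id (𝕜 := ℝ) v).add h1
      refine h2.congr_fderiv ?_
      ext y
      simp [hsymm y v, two_smul]
    obtain ⟨x, hx⟩ := isUnit_one_add_of_bounded_below A hA ((2 : ℝ) • v)
    have hd' : HasStrictFDerivAt G
        ((ContinuousLinearEquiv.unitsEquiv ℝ X x : X ≃L[ℝ] X) : X →L[ℝ] X) v := by
      refine hd.congr_fderiv ?_
      rw [← hx]; rfl
    have := hd'.map_nhds_eq_of_equiv
    rw [← this]
    exact Filter.range_mem_map
  have hclosed : IsClosed (Set.range G) := by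
    refine isClosed_of_closure_subset fun U hU => ?_
    obtain ⟨u, hu, hlim⟩ := mem_closure_iff_seq_limit.1 hU
    choose v hv using hu
    obtain ⟨R, hR⟩ := hlim.norm.bddAbove_range
    obtain ⟨F, hF⟩ := hG R
    have hvF : ∀ n, ‖v n‖ ≤ F := fun n => hF _ (by
      change ‖G (v n)‖ ≤ R
      rw [hv]; exact hR ⟨n, rfl⟩)
    obtain ⟨C, hC, hb⟩ := hA (F + F)
    have hcau : CauchySeq v := by
      have hu := hlim.cauchySeq
      rw [Metric.cauchySeq_iff] at hu ⊢
      intro ε hε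
      obtain ⟨N, hN⟩ := hu (ε / C) (by positivity)
      refine ⟨N, fun m hm n hn => ?_⟩
      have h1 := hN m hm n hn
      have h2 := hb (v m + v n) (v m - v n)
        ((norm_add_le _ _).trans (add_le_add (hvF m) (hvF n)))
      rw [← quadratic_sub A hsymm] at h2
      change _ ≤ C * ‖G (v m) - G (v n)‖ at h2
      rw [hv, hv, ← dist_eq_norm, ← dist_eq_norm] at h2
      calc dist (v m) (v n) ≤ C * dist (u m) (u n) := h2
        _ < C * (ε / C) := by gcongr
        _ = ε := by field_simp
    obtain ⟨w, hw⟩ := cauchySeq_tendsto_of_complete hcau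
    have hcont : Continuous G := by fun_prop
    refine ⟨w, tendsto_nhds_unique ((hcont.tendsto w).comp hw) ?_⟩
    rwa [show G ∘ v = u from funext hv]
  have : Set.range G = Set.univ := IsClopen.eq_univ ⟨hclosed, hopen⟩ ⟨G 0, 0, rfl⟩
  exact Set.range_eq_univ.1 this

end QuadraticMaps

section RealEstimates

open MeasureTheory intervalIntegral Real

theorem sq_integral_abs_mul_le {f g : ℝ → ℝ} (hf : Continuous f) (hg : Continuous g) {T : ℝ}
    (hT : 0 ≤ T) :
    (∫ x in 0..T, |f x * g x|) ^ 2 ≤ (∫ x in 0..T, f x ^ 2) * ∫ x in 0..T, g x ^ 2 := by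
  have hfg : ∀ t : ℝ, 0 ≤ (∫ x in 0..T, g x ^ 2) * (t * t) +
      (-2 * ∫ x in 0..T, |f x * g x|) * t + ∫ x in 0..T, f x ^ 2 := by
    intro t
    have h1 : 0 ≤ ∫ x in 0..T, (|f x| - t * |g x|) ^ 2 :=
      integral_nonneg hT fun x _ => sq_nonneg _
    have h2 : ∀ x, (|f x| - t * |g x|) ^ 2
        = (t * t) * g x ^ 2 + (-2 * t) * |f x * g x| + f x ^ 2 := by
      intro x
      rw [abs_mul, ← sq_abs (f x), ← sq_abs (g x)]; ring
    simp_rw [h2] at h1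
    rw [intervalIntegral.integral_add, intervalIntegral.integral_add, intervalIntegral.integral_const_mul,
      intervalIntegral.integral_const_mul] at h1
    · linarith
    all_goals exact Continuous.intervalIntegrable (by fun_prop) _ _
  have := discrim_le_zero hfg
  rw [discrim] at this
  linarith

/-- `L²` bound for the solution of the linear periodic equation `(w - H)' = c - q w`. -/
theorem integral_sq_le_of_linear {q w H : ℝ → ℝ} {c : ℝ} (hq : Continuous q) (hw : Continuous w)
    (hH : Continuous H) (hz : ∀ x, HasDerivAt (fun x => w x - H x) (c - q x * w x) x)
    (hper : w 0 - H 0 = w (2 * π) - H (2 * π)) (hz0 : ∫ x in 0..(2 * π), (w x - H x) = 0)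
    (hq0 : ∫ x in 0..(2 * π), q x = 0) {K : ℝ} (hK : ∫ x in 0..(2 * π), q x ^ 2 ≤ K) :
    ∫ x in 0..(2 * π), w x ^ 2 ≤
      (4 * π * (exp (2 * (π + K)) * (exp (2 * (π + K)) + 1)) ^ 2 * K + 2) *
        ∫ x in 0..(2 * π), H x ^ 2 := by
  have hpi : (0 : ℝ) ≤ 2 * π := by positivity
  set B := π + K with hB
  set Q : ℝ → ℝ := fun x => ∫ t in 0..x, q t with hQ
  have hQd : ∀ x, HasDerivAt Q (q x) x := fun x =>
    integral_hasDerivAt_right (hq.intervalIntegrable _ _)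
      (hq.stronglyMeasurableAtFilter _ _) hq.continuousAt
  have hQc : Continuous Q := continuous_iff_continuousAt.2 fun x => (hQd x).continuousAt
  have hQ0 : Q 0 = 0 := by simp [hQ]
  have hQ1 : Q (2 * π) = 0 := hq0
  have hsub : ∀ {f : ℝ → ℝ}, Continuous f → (∀ x, 0 ≤ f x) → ∀ a b, 0 ≤ a → a ≤ b →
      b ≤ 2 * π → ∫ x in a..b, f x ≤ ∫ x in 0..(2 * π), f x := by
    intro f hf hf0 a b ha hab hb
    exact integral_mono_interval ha hab hb (Filter.Eventually.of_forall hf0)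
      (hf.intervalIntegrable _ _)
  have hQB : ∀ x ∈ Set.Icc 0 (2 * π), |Q x| ≤ B := by
    intro x hx
    have h1 : |Q x| ≤ ∫ t in 0..x, |q t| := intervalIntegral.abs_integral_le_integral_abs hx.1
    have h2 := hsub hq.abs (fun x => abs_nonneg (q x)) 0 x le_rfl hx.1 hx.2
    have h3 : ∫ t in 0..(2 * π), |q t| ≤ ∫ t in 0..(2 * π), (1 / 2 + q t ^ 2) := by
      refine integral_mono_on hpi (hq.abs.intervalIntegrable _ _)
        (Continuous.intervalIntegrable (by fun_prop) _ _) fun t _ => ?_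
      nlinarith [sq_nonneg (|q t| - 1), sq_abs (q t)]
    rw [intervalIntegral.integral_add (by simp)
      (Continuous.intervalIntegrable (by fun_prop) _ _), intervalIntegral.integral_const] at h3
    simp only [sub_zero, smul_eq_mul] at h3
    linarith
  have hK0 : 0 ≤ K := le_trans (integral_nonneg hpi fun x _ => sq_nonneg _) hK
  have hB0 : 0 ≤ B := by positivity
  have hEle : ∀ x ∈ Set.Icc 0 (2 * π), exp (Q x) ≤ exp B := fun x hx =>
    exp_le_exp.2 (le_of_abs_le (hQB x hx))
  have hEge : ∀ x ∈ Set.Icc 0 (2 * π), exp (-B) ≤ exp (Q x) := fun x hx =>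
    exp_le_exp.2 (neg_le_of_abs_le (hQB x hx))
  set z : ℝ → ℝ := fun x => w x - H x with hzdef
  have hzc : Continuous z := hw.sub hH
  have hwz : ∀ x, w x = z x + H x := fun x => by simp [hzdef]
  have hperz : z 0 = z (2 * π) := hper
  set J := ∫ x in 0..(2 * π), |q x * H x| with hJ
  have hJ0 : 0 ≤ J := integral_nonneg hpi fun x _ => abs_nonneg _
  have hd : ∀ x, HasDerivAt (fun x => exp (Q x) * z x) (exp (Q x) * (c - q x * H x)) x := by
    intro x
    exact ((hQd x).exp.mul (hz x)).congr_deriv (by rw [hwz x]; ring)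
  have hdc : Continuous fun x => exp (Q x) * (c - q x * H x) := by fun_prop
  have hftc : ∀ a b, ∫ x in a..b, exp (Q x) * (c - q x * H x)
      = exp (Q b) * z b - exp (Q a) * z a := fun a b =>
    integral_eq_sub_of_hasDerivAt (fun x _ => hd x) (hdc.intervalIntegrable _ _)
  have hEqH : |∫ x in 0..(2 * π), exp (Q x) * (q x * H x)| ≤ exp B * J := by
    refine (intervalIntegral.abs_integral_le_integral_abs hpi).trans ?_
    rw [hJ, ← intervalIntegral.integral_const_mul]
    refine integral_mono_on hpi (Continuous.intervalIntegrable (by fun_prop) _ _)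
      (Continuous.intervalIntegrable (by fun_prop) _ _) fun x hx => ?_
    rw [abs_mul, abs_of_pos (exp_pos _)]
    exact mul_le_mul_of_nonneg_right (hEle x hx) (abs_nonneg _)
  have hEint : 2 * π * exp (-B) ≤ ∫ x in 0..(2 * π), exp (Q x) := by
    have : ∫ x in 0..(2 * π), exp (-B) ≤ ∫ x in 0..(2 * π), exp (Q x) :=
      integral_mono_on hpi (by simp) (Continuous.intervalIntegrable (by fun_prop) _ _) hEge
    simpa using this
  have hc : 2 * π * |c| ≤ exp (2 * B) * J := by
    have h1 := hftc 0 (2 * π)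
    rw [hQ0, hQ1, ← hperz, sub_self] at h1
    simp_rw [mul_sub] at h1
    rw [intervalIntegral.integral_sub (Continuous.intervalIntegrable (by fun_prop) _ _)
      (Continuous.intervalIntegrable (by fun_prop) _ _),
      intervalIntegral.integral_mul_const] at h1
    have h2 : |c| * ∫ x in 0..(2 * π), exp (Q x) ≤ exp B * J := by
      have h3 : |∫ x in 0..(2 * π), exp (Q x)| = ∫ x in 0..(2 * π), exp (Q x) :=
        abs_of_nonneg (integral_nonneg hpi fun x _ => (exp_pos _).le)
      rw [← h3, ← abs_mul, mul_comm c, sub_eq_zero.1 h1]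
      exact hEqH
    have h4 : |c| * (2 * π * exp (-B)) ≤ exp B * J :=
      (mul_le_mul_of_nonneg_left hEint (abs_nonneg _)).trans h2
    have h5 : exp B * (|c| * (2 * π * exp (-B))) ≤ exp B * (exp B * J) := by gcongr
    have h6 : exp B * exp (-B) = 1 := by rw [← exp_add]; simp
    have h7 : exp (2 * B) = exp B * exp B := by rw [← exp_add]; ring_nf
    calc 2 * π * |c| = 2 * π * |c| * (exp B * exp (-B)) := by rw [h6, mul_one]
      _ = exp B * (|c| * (2 * π * exp (-B))) := by ring
      _ ≤ exp B * (exp B * J) := h5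
      _ = exp (2 * B) * J := by rw [h7]; ring
  obtain ⟨x₀, hx₀, hzx₀⟩ : ∃ x₀ ∈ Set.Icc 0 (2 * π), z x₀ = 0 := by
    by_contra! hne
    have hpos : (0 : ℝ) < 2 * π := by positivity
    rcases lt_or_gt_of_ne (hne 0 ⟨le_rfl, hpi⟩) with h0 | h0
    · have : ∀ x ∈ Set.Icc 0 (2 * π), z x < 0 := by
        intro x hx
        by_contra! hcon
        obtain ⟨y, hy, hy0⟩ := intermediate_value_Icc hx.1 hzc.continuousOn ⟨h0.le, hcon⟩
        exact hne y ⟨hy.1, hy.2.trans hx.2⟩ hy0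
      have h1 : 0 < ∫ x in 0..(2 * π), -z x :=
        intervalIntegral_pos_of_pos_on (hzc.neg.intervalIntegrable _ _)
          (fun x hx => neg_pos.2 (this x ⟨hx.1.le, hx.2.le⟩)) hpos
      rw [intervalIntegral.integral_neg] at h1
      simp [hz0] at h1
    · have : ∀ x ∈ Set.Icc 0 (2 * π), 0 < z x := by
        intro x hx
        by_contra! hcon
        obtain ⟨y, hy, hy0⟩ := intermediate_value_Icc' hx.1 hzc.continuousOn ⟨hcon, h0.le⟩
        exact hne y ⟨hy.1, hy.2.trans hx.2⟩ hy0
      have h1 : 0 < ∫ x in 0..(2 * π), z x :=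
        intervalIntegral_pos_of_pos_on (hzc.intervalIntegrable _ _)
          (fun x hx => this x ⟨hx.1.le, hx.2.le⟩) hpos
      simp [hz0] at h1
  have hEbd : ∫ x in 0..(2 * π), |exp (Q x) * (c - q x * H x)|
      ≤ exp B * ((exp (2 * B) + 1) * J) := by
    have h1 : ∫ x in 0..(2 * π), |exp (Q x) * (c - q x * H x)|
        ≤ ∫ x in 0..(2 * π), exp B * (|c| + |q x * H x|) := by
      refine integral_mono_on hpi (Continuous.intervalIntegrable (by fun_prop) _ _)
        (Continuous.intervalIntegrable (by fun_prop) _ _) fun x hx => ?_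
      rw [abs_mul, abs_of_pos (exp_pos _)]
      exact mul_le_mul (hEle x hx) (abs_sub _ _) (abs_nonneg _) (exp_pos _).le
    rw [intervalIntegral.integral_const_mul, intervalIntegral.integral_add (by simp)
      (Continuous.intervalIntegrable (by fun_prop) _ _), intervalIntegral.integral_const] at h1
    refine h1.trans (mul_le_mul_of_nonneg_left ?_ (exp_pos _).le)
    simp only [sub_zero, smul_eq_mul]
    linarith
  have hzb : ∀ x ∈ Set.Icc 0 (2 * π), |z x| ≤ exp (2 * B) * (exp (2 * B) + 1) * J := by
    intro x hx
    have h1 := hftc x₀ x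
    rw [hzx₀, mul_zero, sub_zero] at h1
    have h2 : |∫ y in x₀..x, exp (Q y) * (c - q y * H y)| ≤
        ∫ x in 0..(2 * π), |exp (Q x) * (c - q x * H x)| := by
      rcases le_total x₀ x with h | h
      · exact (intervalIntegral.abs_integral_le_integral_abs h).trans
          (hsub hdc.abs (fun _ => abs_nonneg _) _ _ hx₀.1 h hx.2)
      · rw [integral_symm, abs_neg]
        exact (intervalIntegral.abs_integral_le_integral_abs h).trans
          (hsub hdc.abs (fun _ => abs_nonneg _) _ _ hx.1 h hx₀.2)
    rw [h1, abs_mul, abs_of_pos (exp_pos _)] at h2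
    have h3 := (mul_le_mul_of_nonneg_right (hEge x hx) (abs_nonneg (z x))).trans (h2.trans hEbd)
    have h4 : exp B * (exp (-B) * |z x|) ≤ exp B * (exp B * ((exp (2 * B) + 1) * J)) := by gcongr
    have h6 : exp B * exp (-B) = 1 := by rw [← exp_add]; simp
    have h7 : exp (2 * B) = exp B * exp B := by rw [← exp_add]; ring_nf
    calc |z x| = exp B * exp (-B) * |z x| := by rw [h6, one_mul]
      _ = exp B * (exp (-B) * |z x|) := by ring
      _ ≤ _ := h4
      _ = exp (2 * B) * (exp (2 * B) + 1) * J := by rw [h7]; ring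
  set L := exp (2 * B) * (exp (2 * B) + 1) with hL
  have hzint : ∫ x in 0..(2 * π), z x ^ 2 ≤ 2 * π * (L * J) ^ 2 := by
    have : ∫ x in 0..(2 * π), z x ^ 2 ≤ ∫ x in 0..(2 * π), (L * J) ^ 2 :=
      integral_mono_on hpi ((hzc.pow 2).intervalIntegrable _ _) (by simp) fun x hx => by
        rw [← sq_abs (z x)]
        exact pow_le_pow_left₀ (abs_nonneg _) (hzb x hx) 2
    simpa using this
  have hJ2 : J ^ 2 ≤ K * ∫ x in 0..(2 * π), H x ^ 2 :=
    (sq_integral_abs_mul_le hq hH hpi).trans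
      (mul_le_mul_of_nonneg_right hK (integral_nonneg hpi fun x _ => sq_nonneg _))
  have hwint : ∫ x in 0..(2 * π), w x ^ 2 ≤
      ∫ x in 0..(2 * π), (2 * z x ^ 2 + 2 * H x ^ 2) :=
    integral_mono_on hpi ((hw.pow 2).intervalIntegrable _ _)
      (Continuous.intervalIntegrable (by fun_prop) _ _) fun x _ => by
        rw [hwz]; nlinarith [sq_nonneg (z x - H x)]
  rw [intervalIntegral.integral_add (Continuous.intervalIntegrable (by fun_prop) _ _)
    (Continuous.intervalIntegrable (by fun_prop) _ _), intervalIntegral.integral_const_mul,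
    intervalIntegral.integral_const_mul] at hwint
  have h8 : 4 * π * L ^ 2 * J ^ 2 ≤ 4 * π * L ^ 2 * (K * ∫ x in 0..(2 * π), H x ^ 2) := by gcongr
  calc _ ≤ _ := hwint
    _ ≤ 4 * π * L ^ 2 * J ^ 2 + 2 * ∫ x in 0..(2 * π), H x ^ 2 := by nlinarith
    _ ≤ _ := by linarith

/-- `L²` a priori bound for the periodic Riccati equation `(v - U)' = c - v²`. -/
theorem riccati_const_le {v U : ℝ → ℝ} {c A : ℝ} (hv : Continuous v) (hU : Continuous U)
    (hy : ∀ x, HasDerivAt (fun x => v x - U x) (c - v x ^ 2) x)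
    (hper : v 0 - U 0 = v (2 * π) - U (2 * π)) (hv0 : ∫ x in 0..(2 * π), v x = 0)
    (hA : ∫ x in 0..(2 * π), U x ^ 2 ≤ A) :
    c ≤ 2 * A * (4 * A + 5) := by
  have hpi : (0 : ℝ) ≤ 2 * π := by positivity
  have hA0 : 0 ≤ A := le_trans (integral_nonneg hpi fun x _ => sq_nonneg _) hA
  set V : ℝ → ℝ := fun x => ∫ t in 0..x, v t with hV
  have hVd : ∀ x, HasDerivAt V (v x) x := fun x =>
    integral_hasDerivAt_right (hv.intervalIntegrable _ _)
      (hv.stronglyMeasurableAtFilter _ _) hv.continuousAt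
  have hVc : Continuous V := continuous_iff_continuousAt.2 fun x => (hVd x).continuousAt
  have hV0 : V 0 = 0 := by simp [hV]
  have hV1 : V (2 * π) = 0 := hv0
  set ρ : ℝ → ℝ := fun x => exp (2 * V x) with hρ
  have hρd : ∀ x, HasDerivAt ρ (ρ x * (2 * v x)) x := fun x => ((hVd x).const_mul 2).exp
  have hρc : Continuous ρ := by fun_prop
  have hρ0 : ∀ x, 0 < ρ x := fun x => exp_pos _
  set N := ∫ x in 0..(2 * π), ρ x with hN
  set P := ∫ x in 0..(2 * π), v x ^ 2 * ρ x with hP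
  have hNpos : 0 < N := intervalIntegral_pos_of_pos (hρc.intervalIntegrable _ _) hρ0
    (by positivity)
  have hP0 : 0 ≤ P := integral_nonneg hpi fun x _ => by positivity [hρ0 x]
  have hmain : c * N + P = ∫ x in 0..(2 * π), 2 * (U x * v x) * ρ x := by
    have hd : ∀ x, HasDerivAt (fun x => (v x - U x) * ρ x)
        (c * ρ x + v x ^ 2 * ρ x - 2 * (U x * v x) * ρ x) x := by
      intro x
      exact ((hy x).mul (hρd x)).congr_deriv (by ring)
    have h1 := integral_eq_sub_of_hasDerivAt (a := 0) (b := 2 * π) (fun x _ => hd x)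
      (Continuous.intervalIntegrable (by fun_prop) _ _)
    rw [intervalIntegral.integral_sub (Continuous.intervalIntegrable (by fun_prop) _ _)
      (Continuous.intervalIntegrable (by fun_prop) _ _),
      intervalIntegral.integral_add (Continuous.intervalIntegrable (by fun_prop) _ _)
      (Continuous.intervalIntegrable (by fun_prop) _ _),
      intervalIntegral.integral_const_mul, ← hper] at h1
    simp only [hρ, hV0, hV1, sub_self] at h1
    exact sub_eq_zero.1 h1
  have hcross : ∫ x in 0..(2 * π), 2 * (U x * v x) * ρ x ≤
      P / 2 + 2 * ∫ x in 0..(2 * π), U x ^ 2 * ρ x := by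
    have : ∫ x in 0..(2 * π), 2 * (U x * v x) * ρ x ≤
        ∫ x in 0..(2 * π), ((1 / 2) * (v x ^ 2 * ρ x) + 2 * (U x ^ 2 * ρ x)) :=
      integral_mono_on hpi (Continuous.intervalIntegrable (by fun_prop) _ _)
        (Continuous.intervalIntegrable (by fun_prop) _ _) fun x _ => by
          nlinarith [mul_nonneg (sq_nonneg (v x - 2 * U x)) (hρ0 x).le]
    rw [intervalIntegral.integral_add (Continuous.intervalIntegrable (by fun_prop) _ _)
      (Continuous.intervalIntegrable (by fun_prop) _ _), intervalIntegral.integral_const_mul,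
      intervalIntegral.integral_const_mul] at this
    linarith
  set M := N + P / (4 * (A + 1)) + 4 * (A + 1) * N with hM
  have hsup : ∀ x ∈ Set.Icc 0 (2 * π), ρ x ≤ M := by
    intro x hx
    have hvar : ∀ y ∈ Set.Icc 0 (2 * π), ρ x ≤ ρ y + (P / (4 * (A + 1)) + 4 * (A + 1) * N) := by
      intro y hy'
      have hdc : Continuous fun x => ρ x * (2 * v x) := by fun_prop
      have h1 : ∫ t in y..x, ρ t * (2 * v t) = ρ x - ρ y :=
        integral_eq_sub_of_hasDerivAt (fun t _ => hρd t) (hdc.intervalIntegrable _ _)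
      have h2 : |∫ t in y..x, ρ t * (2 * v t)| ≤ ∫ t in 0..(2 * π), |ρ t * (2 * v t)| := by
        rcases le_total y x with h | h
        · exact (intervalIntegral.abs_integral_le_integral_abs h).trans
            (integral_mono_interval hy'.1 h hx.2
              (Filter.Eventually.of_forall fun _ => abs_nonneg _)
              (hdc.abs.intervalIntegrable _ _))
        · rw [integral_symm, abs_neg]
          exact (intervalIntegral.abs_integral_le_integral_abs h).trans
            (integral_mono_interval hx.1 h hy'.2
              (Filter.Eventually.of_forall fun _ => abs_nonneg _)
              (hdc.abs.intervalIntegrable _ _))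
      have h3 : ∫ t in 0..(2 * π), |ρ t * (2 * v t)| ≤
          ∫ t in 0..(2 * π), ((1 / (4 * (A + 1))) * (v t ^ 2 * ρ t) + 4 * (A + 1) * ρ t) :=
        integral_mono_on hpi (Continuous.intervalIntegrable (by fun_prop) _ _)
          (Continuous.intervalIntegrable (by fun_prop) _ _) fun t _ => by
            rw [abs_mul, abs_of_pos (hρ0 t), abs_mul, abs_two]
            set e := 4 * (A + 1) with he
            have he0 : 0 < e := by positivity
            have h4 : 0 ≤ (1 / e) * (|v t| - e) ^ 2 * ρ t := by positivity [hρ0 t]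
            have h5 : (1 / e) * (|v t| - e) ^ 2 * ρ t =
                (1 / e) * (v t ^ 2 * ρ t) - ρ t * (2 * |v t|) + e * ρ t := by
              rw [← sq_abs (v t)]; field_simp; ring
            linarith
      rw [intervalIntegral.integral_add (Continuous.intervalIntegrable (by fun_prop) _ _)
        (Continuous.intervalIntegrable (by fun_prop) _ _), intervalIntegral.integral_const_mul,
        intervalIntegral.integral_const_mul] at h3
      have h6 := le_of_abs_le (h2.trans h3)
      rw [h1, ← hP, ← hN, one_div_mul_eq_div] at h6
      linarith
    have h7 : ∫ y in 0..(2 * π), ρ x ≤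
        ∫ y in 0..(2 * π), (ρ y + (P / (4 * (A + 1)) + 4 * (A + 1) * N)) :=
      integral_mono_on hpi (by simp) (Continuous.intervalIntegrable (by fun_prop) _ _) hvar
    rw [intervalIntegral.integral_add (hρc.intervalIntegrable _ _) (by simp),
      intervalIntegral.integral_const, intervalIntegral.integral_const, ← hN] at h7
    simp only [sub_zero, smul_eq_mul] at h7
    have h8 : N ≤ 2 * π * N := by nlinarith [pi_gt_three]
    have h9 : (2 * π) * ρ x ≤ 2 * π * M := by rw [hM]; linarith
    exact le_of_mul_le_mul_left h9 (by positivity)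
  have hM0 : 0 ≤ M := by positivity
  have hUρ : ∫ x in 0..(2 * π), U x ^ 2 * ρ x ≤ A * M := by
    have : ∫ x in 0..(2 * π), U x ^ 2 * ρ x ≤ ∫ x in 0..(2 * π), U x ^ 2 * M :=
      integral_mono_on hpi (Continuous.intervalIntegrable (by fun_prop) _ _)
        (Continuous.intervalIntegrable (by fun_prop) _ _) fun x hx =>
          mul_le_mul_of_nonneg_left (hsup x hx) (sq_nonneg _)
    rw [intervalIntegral.integral_mul_const] at this
    exact this.trans (mul_le_mul_of_nonneg_right hA hM0)
  have hfrac : A * (P / (4 * (A + 1))) ≤ P / 4 := by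
    rw [mul_div_assoc', div_le_div_iff₀ (by positivity) (by norm_num)]
    nlinarith
  have hfin : c * N ≤ (2 * A * (4 * A + 5)) * N := by
    have h10 : A * M = A * N + A * (P / (4 * (A + 1))) + A * (4 * (A + 1) * N) := by
      rw [hM]; ring
    nlinarith
  exact le_of_mul_le_mul_right hfin hNpos

end RealEstimates

section SequenceSpaces

open Real Complex

theorem summable_mul_and_tsum_mul_le_sqrt {ι : Type*} {f g : ι → ℝ} (hf : ∀ i, 0 ≤ f i)
    (hg : ∀ i, 0 ≤ g i) (hf2 : Summable fun i => f i ^ 2) (hg2 : Summable fun i => g i ^ 2) :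
    (Summable fun i => f i * g i) ∧
      ∑' i, f i * g i ≤ √(∑' i, f i ^ 2) * √(∑' i, g i ^ 2) := by
  have h := Real.summable_and_inner_le_Lp_mul_Lq_tsum_of_nonneg (p := 2) (q := 2)
    Real.HolderConjugate.two_two hf hg (by simpa using hf2) (by simpa using hg2)
  simpa [Real.sqrt_eq_rpow] using h

theorem hsNorm_nonneg (s : ℝ) (a : ℤ → ℂ) : 0 ≤ hsNorm s a := Real.sqrt_nonneg _

theorem one_add_sq_pos (k : ℤ) : (0 : ℝ) < 1 + (k : ℝ) ^ 2 := by positivity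

theorem hsNorm_sq (s : ℝ) (a : ℤ → ℂ) :
    hsNorm s a ^ 2 = ∑' k : ℤ, (1 + (k : ℝ) ^ 2) ^ s * ‖a k‖ ^ 2 :=
  Real.sq_sqrt (tsum_nonneg fun _ => by positivity)

theorem hsNorm_le_of_le {s c : ℝ} {a : ℤ → ℂ} {g : ℤ → ℝ} (hc : 0 ≤ c) (hg : Summable g)
    (h : ∀ k : ℤ, (1 + (k : ℝ) ^ 2) ^ s * ‖a k‖ ^ 2 ≤ g k) (hgc : ∑' k, g k ≤ c ^ 2) :
    InHs s a ∧ hsNorm s a ≤ c := by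
  have hs : InHs s a := Summable.of_nonneg_of_le (fun _ => by positivity) h hg
  exact ⟨hs, Real.sqrt_le_iff.2 ⟨hc, (hs.tsum_le_tsum h hg).trans hgc⟩⟩

theorem InHs.mono {s t : ℝ} (hst : s ≤ t) {a : ℤ → ℂ} (ha : InHs t a) :
    InHs s a ∧ hsNorm s a ≤ hsNorm t a := by
  refine hsNorm_le_of_le (hsNorm_nonneg _ _) ha (fun k => ?_) (hsNorm_sq t a).ge
  have : (1 + (k : ℝ) ^ 2) ^ s ≤ (1 + (k : ℝ) ^ 2) ^ t :=
    Real.rpow_le_rpow_of_exponent_le (by nlinarith [sq_nonneg (k : ℝ)]) hst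
  gcongr

theorem InHs.sub {s : ℝ} {a b : ℤ → ℂ} (ha : InHs s a) (hb : InHs s b) :
    InHs s (fun k => a k - b k) ∧
      hsNorm s (fun k => a k - b k) ≤ 2 * (hsNorm s a + hsNorm s b) := by
  refine hsNorm_le_of_le (by positivity [hsNorm_nonneg s a, hsNorm_nonneg s b])
    ((ha.mul_left 2).add (hb.mul_left 2)) (fun k => ?_) ?_
  · have h1 : ‖a k - b k‖ ^ 2 ≤ 2 * ‖a k‖ ^ 2 + 2 * ‖b k‖ ^ 2 := by
      have := norm_sub_le (a k) (b k)
      nlinarith [norm_nonneg (a k - b k), sq_nonneg (‖a k‖ - ‖b k‖)]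
    have h2 : (0 : ℝ) ≤ (1 + (k : ℝ) ^ 2) ^ s := by positivity
    nlinarith
  · rw [(ha.mul_left 2).tsum_add (hb.mul_left 2), tsum_mul_left, tsum_mul_left, ← hsNorm_sq,
      ← hsNorm_sq]
    nlinarith [hsNorm_nonneg s a, hsNorm_nonneg s b]

theorem InHs.neg {s : ℝ} {b : ℤ → ℂ} (hb : InHs s b) : InHs s (fun k => -b k) := by
  simpa [InHs] using hb

theorem hsNorm_neg (s : ℝ) (b : ℤ → ℂ) : hsNorm s (fun k => -b k) = hsNorm s b := by
  simp [hsNorm]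

theorem InHs.add {s : ℝ} {a b : ℤ → ℂ} (ha : InHs s a) (hb : InHs s b) :
    InHs s (fun k => a k + b k) ∧
      hsNorm s (fun k => a k + b k) ≤ 2 * (hsNorm s a + hsNorm s b) := by
  have := ha.sub hb.neg
  simpa only [sub_neg_eq_add, hsNorm_neg] using this

theorem one_add_sq_rpow_half_sq (s : ℝ) (k : ℤ) :
    ((1 + (k : ℝ) ^ 2) ^ (s / 2)) ^ 2 = (1 + (k : ℝ) ^ 2) ^ s := by
  rw [← Real.rpow_natCast, ← Real.rpow_mul (one_add_sq_pos k).le]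
  congr 1; push_cast; ring

/-- Peetre's inequality for the weights, in multiplicative form. -/
theorem one_add_sq_rpow_le {σ : ℝ} (hσ : 0 ≤ σ) (k j : ℤ) :
    (1 + (k : ℝ) ^ 2) ^ σ ≤
      2 ^ σ * ((1 + (j : ℝ) ^ 2) ^ σ * (1 + ((k - j : ℤ) : ℝ) ^ 2) ^ σ) := by
  rw [← Real.mul_rpow (by positivity) (by positivity),
    ← Real.mul_rpow (by positivity) (by positivity)]
  refine Real.rpow_le_rpow (by positivity) ?_ hσ
  push_cast
  nlinarith [sq_nonneg ((j : ℝ) - (k - j)), sq_nonneg ((j : ℝ) * (k - j))]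

theorem seqConv_bound {σ : ℝ} (hσ : 0 ≤ σ) {a b : ℤ → ℂ} (ha : InHs σ a) (hb : InHs σ b) (k : ℤ) :
    (Summable fun j => a j * b (k - j)) ∧
      (1 + (k : ℝ) ^ 2) ^ (σ / 2) * ‖seqConv a b k‖ ≤
        2 ^ (σ / 2) * (hsNorm σ a * hsNorm σ b) := by
  set wt : ℤ → ℝ := fun j => (1 + (j : ℝ) ^ 2) ^ (σ / 2) with hwt
  have hwt1 : ∀ j, 1 ≤ wt j := fun j =>
    Real.one_le_rpow (by nlinarith [sq_nonneg (j : ℝ)]) (by positivity)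
  set f : ℤ → ℝ := fun j => wt j * ‖a j‖ with hf
  set g : ℤ → ℝ := fun j => wt j * ‖b j‖ with hg
  have hf2 : ∀ j, f j ^ 2 = (1 + (j : ℝ) ^ 2) ^ σ * ‖a j‖ ^ 2 := fun j => by
    rw [hf, mul_pow, hwt, one_add_sq_rpow_half_sq]
  have hg2 : ∀ j, g j ^ 2 = (1 + (j : ℝ) ^ 2) ^ σ * ‖b j‖ ^ 2 := fun j => by
    rw [hg, mul_pow, hwt, one_add_sq_rpow_half_sq]
  have hfs : Summable fun j => f j ^ 2 := by simp only [hf2]; exact ha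
  have hgs : Summable fun j => g j ^ 2 := by simp only [hg2]; exact hb
  have hf0 : ∀ j, 0 ≤ f j := fun j => by positivity
  have hg0 : ∀ j, 0 ≤ g j := fun j => by positivity
  have hgs' : Summable fun j => g (k - j) ^ 2 := (Equiv.subLeft k).summable_iff.2 hgs
  have hgt : ∑' j, g (k - j) ^ 2 = ∑' j, g j ^ 2 :=
    (Equiv.subLeft k).tsum_eq fun j => g j ^ 2
  obtain ⟨h1, h2⟩ := summable_mul_and_tsum_mul_le_sqrt hf0 (fun j => hg0 (k - j)) hfs hgs'
  have hle : ∀ j, ‖a j * b (k - j)‖ ≤ f j * g (k - j) := fun j => by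
    rw [norm_mul]
    exact mul_le_mul (le_mul_of_one_le_left (norm_nonneg _) (hwt1 j))
      (le_mul_of_one_le_left (norm_nonneg _) (hwt1 _)) (norm_nonneg _) (hf0 j)
  have hsn : Summable fun j => ‖a j * b (k - j)‖ :=
    Summable.of_nonneg_of_le (fun _ => norm_nonneg _) hle h1
  refine ⟨hsn.of_norm, ?_⟩
  have h3 : ‖seqConv a b k‖ ≤ ∑' j, ‖a j * b (k - j)‖ := norm_tsum_le_tsum_norm hsn
  calc (1 + (k : ℝ) ^ 2) ^ (σ / 2) * ‖seqConv a b k‖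
      ≤ (1 + (k : ℝ) ^ 2) ^ (σ / 2) * ∑' j, ‖a j * b (k - j)‖ := by gcongr
    _ = ∑' j, (1 + (k : ℝ) ^ 2) ^ (σ / 2) * ‖a j * b (k - j)‖ := tsum_mul_left.symm
    _ ≤ ∑' j, 2 ^ (σ / 2) * (f j * g (k - j)) := by
        refine (hsn.mul_left _).tsum_le_tsum (fun j => ?_) (h1.mul_left _)
        have h4 := one_add_sq_rpow_le (σ := σ / 2) (by positivity) k j
        rw [norm_mul]
        calc _ ≤ (2 ^ (σ / 2) * (wt j * wt (k - j))) * (‖a j‖ * ‖b (k - j)‖) := by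
              gcongr
          _ = _ := by simp only [hf, hg]; ring
    _ = 2 ^ (σ / 2) * ∑' j, f j * g (k - j) := tsum_mul_left
    _ ≤ 2 ^ (σ / 2) * (hsNorm σ a * hsNorm σ b) := by
        refine mul_le_mul_of_nonneg_left (h2.trans_eq ?_) (by positivity)
        rw [hgt]
        simp only [hf2, hg2, hsNorm]

theorem seqConv_comm (a b : ℤ → ℂ) (k : ℤ) : seqConv a b k = seqConv b a k := by
  rw [seqConv, seqConv, ← (Equiv.subLeft k).tsum_eq]
  exact tsum_congr fun j => by simp [mul_comm]

theorem IsRealSeq.seqConv {a b : ℤ → ℂ} (ha : IsRealSeq a) (hb : IsRealSeq b) :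
    IsRealSeq (seqConv a b) := by
  intro k
  rw [_root_.seqConv, _root_.seqConv, Complex.conj_tsum, ← (Equiv.neg ℤ).tsum_eq]
  refine tsum_congr fun j => ?_
  rw [map_mul, ← ha, ← hb]
  simp only [Equiv.neg_apply]
  congr 2; ring

/-- Fourier coefficients of the mean-zero antiderivative. -/
noncomputable def antideriv (a : ℤ → ℂ) (k : ℤ) : ℂ := (I * (k : ℂ))⁻¹ * a k

@[simp] theorem antideriv_zero (a : ℤ → ℂ) : antideriv a 0 = 0 := by simp [antideriv]

theorem IsRealSeq.antideriv {a : ℤ → ℂ} (ha : IsRealSeq a) : IsRealSeq (antideriv a) := by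
  intro k
  simp only [_root_.antideriv, map_mul, map_inv₀, Complex.conj_I, ha k, map_intCast]
  push_cast
  ring_nf

theorem exists_hsNorm_antideriv_seqConv_le {σ : ℝ} (hσ : 0 ≤ σ) :
    ∃ C : ℝ, 0 ≤ C ∧ ∀ a b : ℤ → ℂ, InHs σ a → InHs σ b →
      InHs (σ + 1 / 3) (antideriv (seqConv a b)) ∧
        hsNorm (σ + 1 / 3) (antideriv (seqConv a b)) ≤ C * (hsNorm σ a * hsNorm σ b) := by
  set ζ : ℤ → ℝ := fun k => 2 ^ (1 / 3 : ℝ) * |(k : ℝ)| ^ (-(4 / 3) : ℝ) with hζ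
  have hζs : Summable ζ := (Real.summable_abs_int_rpow (by norm_num)).mul_left _
  have hζ0 : 0 ≤ ∑' k, ζ k := tsum_nonneg fun k => by positivity
  refine ⟨2 ^ (σ / 2) * √(∑' k, ζ k), by positivity, fun a b ha hb => ?_⟩
  have hN : 0 ≤ hsNorm σ a * hsNorm σ b := mul_nonneg (hsNorm_nonneg _ _) (hsNorm_nonneg _ _)
  refine hsNorm_le_of_le (by positivity)
    (hζs.mul_left ((2 ^ (σ / 2) * (hsNorm σ a * hsNorm σ b)) ^ 2)) (fun k => ?_) ?_
  · rcases eq_or_ne k 0 with rfl | hk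
    · simp only [antideriv_zero, norm_zero]
      have : 0 ≤ ζ 0 := by positivity
      norm_num
      positivity
    have h1 := (seqConv_bound hσ ha hb k).2
    have h2 := pow_le_pow_left₀ (by positivity) h1 2
    rw [mul_pow, one_add_sq_rpow_half_sq] at h2
    have hk1 : (1 : ℝ) ≤ (k : ℝ) ^ 2 := by
      have : (1 : ℤ) ≤ k ^ 2 := by have := sq_pos_of_ne_zero hk; omega
      exact_mod_cast this
    have hk0 : (0 : ℝ) < |(k : ℝ)| := abs_pos.2 (by exact_mod_cast hk)
    have h3 : ‖antideriv (seqConv a b) k‖ ^ 2 = ((k : ℝ) ^ 2)⁻¹ * ‖seqConv a b k‖ ^ 2 := by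
      rw [antideriv, norm_mul, mul_pow, norm_inv, norm_mul, Complex.norm_I, one_mul,
        Complex.norm_intCast, inv_pow, sq_abs]
    have h4 : (1 + (k : ℝ) ^ 2) ^ (1 / 3 : ℝ) * ((k : ℝ) ^ 2)⁻¹ ≤ ζ k := by
      have h5 : (1 + (k : ℝ) ^ 2) ^ (1 / 3 : ℝ) ≤ (2 * (k : ℝ) ^ 2) ^ (1 / 3 : ℝ) :=
        Real.rpow_le_rpow (by positivity) (by linarith) (by norm_num)
      have h6 : ((k : ℝ) ^ 2) = |(k : ℝ)| ^ (2 : ℝ) := by simp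
      calc _ ≤ (2 * (k : ℝ) ^ 2) ^ (1 / 3 : ℝ) * ((k : ℝ) ^ 2)⁻¹ := by gcongr
        _ = ζ k := by
          rw [Real.mul_rpow (by norm_num) (by positivity), h6, ← Real.rpow_mul hk0.le,
            ← Real.rpow_neg hk0.le, mul_assoc, ← Real.rpow_add hk0]
          norm_num [hζ]
    calc (1 + (k : ℝ) ^ 2) ^ (σ + 1 / 3) * ‖antideriv (seqConv a b) k‖ ^ 2
        = ((1 + (k : ℝ) ^ 2) ^ (1 / 3 : ℝ) * ((k : ℝ) ^ 2)⁻¹) *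
            ((1 + (k : ℝ) ^ 2) ^ σ * ‖seqConv a b k‖ ^ 2) := by
          rw [h3, Real.rpow_add (one_add_sq_pos k)]; ring
      _ ≤ ζ k * (2 ^ (σ / 2) * (hsNorm σ a * hsNorm σ b)) ^ 2 := by gcongr
      _ = _ := mul_comm _ _
  · rw [tsum_mul_left]
    refine le_of_eq ?_
    nth_rw 1 [← Real.sq_sqrt hζ0]
    ring

end SequenceSpaces

section MeanZeroSpace

open Topology

theorem inHs_zero_iff {a : ℤ → ℂ} : InHs 0 a ↔ Memℓp a 2 := by
  rw [memℓp_gen_iff (by norm_num)]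
  simp [InHs]

/-- The space of real-valued mean-zero functions in `L²`, through Fourier coefficients. -/
noncomputable def meanZeroSubmodule : Submodule ℝ (lp (fun _ : ℤ => ℂ) 2) where
  carrier := {x | x 0 = 0 ∧ IsRealSeq x}
  add_mem' := by
    rintro x y ⟨hx, hx'⟩ ⟨hy, hy'⟩
    refine ⟨by simp [hx, hy], fun k => ?_⟩
    simp [hx' k, hy' k]
  zero_mem' := ⟨rfl, fun k => by simp⟩
  smul_mem' := by
    rintro c x ⟨hx, hx'⟩
    refine ⟨by simp [hx], fun k => ?_⟩
    simp [hx' k]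

theorem isClosed_meanZeroSubmodule : IsClosed (meanZeroSubmodule : Set (lp (fun _ : ℤ => ℂ) 2)) := by
  have hc : ∀ k : ℤ, Continuous fun x : lp (fun _ : ℤ => ℂ) 2 => x k := fun k =>
    (lp.evalCLM ℝ (fun _ : ℤ => ℂ) 2 k).continuous
  change IsClosed {x : lp (fun _ : ℤ => ℂ) 2 | x 0 = 0 ∧ ∀ k, x (-k) = starRingEnd ℂ (x k)}
  rw [Set.ofPred_and, Set.ofPred_forall]
  exact (isClosed_eq (hc 0) continuous_const).inter (isClosed_iInter fun k =>
    isClosed_eq (hc _) (Complex.continuous_conj.comp (hc k)))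

/-- Real-valued mean-zero functions in `L²`, as a real Banach space. -/
abbrev MeanZeroReal : Type := meanZeroSubmodule

noncomputable instance : CompleteSpace MeanZeroReal :=
  isClosed_meanZeroSubmodule.completeSpace_coe

namespace MeanZeroReal

/-- The Fourier coefficients of an element of `MeanZeroReal`. -/
def coeff (x : MeanZeroReal) : ℤ → ℂ := (x : lp (fun _ : ℤ => ℂ) 2)

theorem coeff_zero (x : MeanZeroReal) : x.coeff 0 = 0 := x.2.1

theorem isRealSeq_coeff (x : MeanZeroReal) : IsRealSeq x.coeff := x.2.2

theorem inHs_coeff (x : MeanZeroReal) : InHs 0 x.coeff :=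
  inHs_zero_iff.2 (lp.memℓp (x : lp (fun _ : ℤ => ℂ) 2))

@[ext] theorem ext {x y : MeanZeroReal} (h : ∀ k, x.coeff k = y.coeff k) : x = y :=
  Subtype.ext (lp.ext (funext h))

theorem coeff_add (x y : MeanZeroReal) (k : ℤ) : (x + y).coeff k = x.coeff k + y.coeff k := rfl

theorem coeff_sub (x y : MeanZeroReal) (k : ℤ) : (x - y).coeff k = x.coeff k - y.coeff k := rfl

theorem coeff_smul (c : ℝ) (x : MeanZeroReal) (k : ℤ) : (c • x).coeff k = c * x.coeff k := by
  change c • x.coeff k = _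
  simp

theorem norm_eq (x : MeanZeroReal) : ‖x‖ = hsNorm 0 x.coeff := by
  have h := lp.norm_rpow_eq_tsum (p := 2) (by norm_num) (x : lp (fun _ : ℤ => ℂ) 2)
  have h2 : ‖x‖ ^ 2 = hsNorm 0 x.coeff ^ 2 := by
    rw [hsNorm_sq]
    simpa [coeff] using h
  exact (sq_eq_sq₀ (norm_nonneg _) (hsNorm_nonneg _ _)).1 h2

theorem norm_sq_eq (x : MeanZeroReal) : ‖x‖ ^ 2 = ∑' k, ‖x.coeff k‖ ^ 2 := by
  rw [norm_eq, hsNorm_sq]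
  simp

/-- The element of `MeanZeroReal` with given Fourier coefficients. -/
def mk (a : ℤ → ℂ) (h0 : a 0 = 0) (hr : IsRealSeq a) (ha : InHs 0 a) : MeanZeroReal :=
  ⟨⟨a, inHs_zero_iff.1 ha⟩, h0, hr⟩

@[simp] theorem coeff_mk (a : ℤ → ℂ) (h0 : a 0 = 0) (hr : IsRealSeq a) (ha : InHs 0 a) :
    (mk a h0 hr ha).coeff = a := rfl

theorem summable_mul (x y : MeanZeroReal) (k : ℤ) :
    Summable fun j => x.coeff j * y.coeff (k - j) :=
  (seqConv_bound le_rfl x.inHs_coeff y.inHs_coeff k).1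

/-- The constant in the estimate of `exists_hsNorm_antideriv_seqConv_le` for `σ = 0`. -/
noncomputable def convConst : ℝ := (exists_hsNorm_antideriv_seqConv_le le_rfl).choose

theorem convConst_spec (x y : MeanZeroReal) :
    InHs 0 (antideriv (seqConv x.coeff y.coeff)) ∧
      hsNorm 0 (antideriv (seqConv x.coeff y.coeff)) ≤ convConst * (‖x‖ * ‖y‖) := by
  obtain ⟨h1, h2⟩ := (exists_hsNorm_antideriv_seqConv_le le_rfl).choose_spec.2 _ _
    x.inHs_coeff y.inHs_coeff
  obtain ⟨h3, h4⟩ := h1.mono (s := 0) (by norm_num)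
  rw [norm_eq, norm_eq]
  exact ⟨h3, h4.trans h2⟩

/-- The bounded bilinear map sending `v, w` to the mean-zero antiderivative of
`v w - P₀ (v w)`. -/
noncomputable def invConv : MeanZeroReal →L[ℝ] MeanZeroReal →L[ℝ] MeanZeroReal :=
  LinearMap.mkContinuous₂
    (LinearMap.mk₂ ℝ
      (fun x y => mk (antideriv (seqConv x.coeff y.coeff)) (antideriv_zero _)
        (x.isRealSeq_coeff.seqConv y.isRealSeq_coeff).antideriv (convConst_spec x y).1)
      (fun x x' y => by
        ext k
        simp only [coeff_mk, coeff_add, antideriv, seqConv, add_mul]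
        rw [(summable_mul x y k).tsum_add (summable_mul x' y k), mul_add])
      (fun c x y => by
        ext k
        simp only [coeff_mk, coeff_smul, antideriv, seqConv, mul_assoc]
        rw [tsum_mul_left]; ring)
      (fun x y y' => by
        ext k
        simp only [coeff_mk, coeff_add, antideriv, seqConv, mul_add]
        rw [(summable_mul x y k).tsum_add (summable_mul x y' k), mul_add])
      (fun c x y => by
        ext k
        simp only [coeff_mk, coeff_smul, antideriv, seqConv, mul_left_comm _ (c : ℂ)]
        rw [tsum_mul_left]; ring))
    convConst
    (fun x y => by
      rw [norm_eq (LinearMap.mk₂ ℝ _ _ _ _ _ x y), mul_assoc]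
      exact (convConst_spec x y).2)

theorem coeff_invConv (x y : MeanZeroReal) :
    (invConv x y).coeff = antideriv (seqConv x.coeff y.coeff) := rfl

theorem invConv_comm (x y : MeanZeroReal) : invConv x y = invConv y x := by
  ext k
  rw [coeff_invConv, coeff_invConv, antideriv, antideriv, seqConv_comm]

/-- Truncation to frequencies in `[-N, N]`. -/
noncomputable def trunc (N : ℕ) (x : MeanZeroReal) : MeanZeroReal :=
  mk (fun k => if k ∈ Finset.Icc (-(N : ℤ)) N then x.coeff k else 0) (by simp [coeff_zero])
    (fun k => by
      have : -k ∈ Finset.Icc (-(N : ℤ)) N ↔ k ∈ Finset.Icc (-(N : ℤ)) N := by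
        simp only [Finset.mem_Icc]; omega
      simp only [this, x.isRealSeq_coeff k]
      split_ifs <;> simp)
    (by
      refine Summable.of_nonneg_of_le (fun _ => by positivity) (fun k => ?_) x.inHs_coeff
      beta_reduce
      split_ifs
      · exact le_rfl
      · simp)

theorem coeff_trunc (N : ℕ) (x : MeanZeroReal) (k : ℤ) :
    (trunc N x).coeff k = if k ∈ Finset.Icc (-(N : ℤ)) N then x.coeff k else 0 := rfl

theorem coeff_trunc_eq_zero {N : ℕ} {x : MeanZeroReal} {k : ℤ}
    (hk : k ∉ Finset.Icc (-(N : ℤ)) N) : (trunc N x).coeff k = 0 := by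
  rw [coeff_trunc, if_neg hk]

theorem tendsto_trunc (x : MeanZeroReal) :
    Filter.Tendsto (fun N => trunc N x) Filter.atTop (𝓝 x) := by
  have h1 := lp.hasSum_single (p := 2) (by norm_num) (x : lp (fun _ : ℤ => ℂ) 2)
  have h2 := h1.comp (Finset.tendsto_Icc_neg_atTop_atTop.comp tendsto_natCast_atTop_atTop)
  rw [tendsto_subtype_rng]
  convert h2 using 2 with N
  ext k
  change (trunc N x).coeff k = _
  simp only [coeff_trunc, Function.comp, lp.coeFn_sum, Finset.sum_apply, lp.single_apply]
  simp [Pi.single_apply, coeff]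

end MeanZeroReal

end MeanZeroSpace

section TrigPolynomials

open Real Complex MeasureTheory

/-- The trigonometric polynomial of degree at most `M` with coefficients `a`. -/
noncomputable def trigPoly (M : ℕ) (a : ℤ → ℂ) (x : ℝ) : ℂ :=
  ∑ k ∈ Finset.Icc (-(M : ℤ)) M, a k * cexp (k * x * I)

theorem hasDerivAt_trigPoly (M : ℕ) (a : ℤ → ℂ) (x : ℝ) :
    HasDerivAt (trigPoly M a) (trigPoly M (fun k => I * k * a k) x) x := by
  refine (HasDerivAt.fun_sum (u := Finset.Icc (-(M : ℤ)) M)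
    (A := fun (k : ℤ) (x : ℝ) => a k * cexp (k * x * I))
    (A' := fun k => I * k * a k * cexp (k * x * I)) fun k _ => ?_)
  have h1 : HasDerivAt (fun x : ℝ => (k : ℂ) * x * I) (k * 1 * I) x :=
    ((Complex.ofRealCLM.hasDerivAt (x := x)).const_mul (k : ℂ)).mul_const I
  exact (h1.cexp.const_mul (a k)).congr_deriv (by ring)

theorem trigPoly_two_pi (M : ℕ) (a : ℤ → ℂ) : trigPoly M a (2 * π) = trigPoly M a 0 := by
  refine Finset.sum_congr rfl fun k _ => ?_
  congr 1
  rw [show ((k : ℂ) * ((2 * π : ℝ) : ℂ) * I) = k * (2 * π * I) by push_cast; ring,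
    Complex.exp_int_mul_two_pi_mul_I]
  simp

theorem integral_trigPoly (M : ℕ) (a : ℤ → ℂ) :
    ∫ x in (0 : ℝ)..(2 * π), trigPoly M a x = 2 * π * a 0 := by
  have hterm : ∀ k : ℤ, ∫ x in (0 : ℝ)..(2 * π), a k * cexp (k * x * I) =
      if k = 0 then 2 * π * a 0 else 0 := by
    intro k
    split_ifs with hk
    · subst hk
      simp
    · have hk' : (k : ℂ) * I ≠ 0 := mul_ne_zero (by exact_mod_cast hk) I_ne_zero
      have h1 : ∀ x : ℝ, (k : ℂ) * x * I = (k * I) * x := fun x => by ring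
      rw [intervalIntegral.integral_const_mul]
      simp only [h1]
      rw [integral_exp_mul_complex hk',
        show (k : ℂ) * I * ((2 * π : ℝ) : ℂ) = k * (2 * π * I) by push_cast; ring,
        Complex.exp_int_mul_two_pi_mul_I]
      simp
  simp only [trigPoly]
  rw [intervalIntegral.integral_finsetSum fun k _ => ?_]
  · simp only [hterm]
    simp
  · apply Continuous.intervalIntegrable
    fun_prop

theorem trigPoly_sub (M : ℕ) (a b : ℤ → ℂ) (x : ℝ) :
    trigPoly M (fun k => a k - b k) x = trigPoly M a x - trigPoly M b x := by
  simp only [trigPoly, sub_mul, Finset.sum_sub_distrib]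

theorem trigPoly_ite (M : ℕ) (c : ℂ) (x : ℝ) :
    trigPoly M (fun k => if k = 0 then c else 0) x = c := by
  simp [trigPoly]

theorem conj_trigPoly (M : ℕ) {a : ℤ → ℂ} (ha : IsRealSeq a) (x : ℝ) :
    starRingEnd ℂ (trigPoly M a x) = trigPoly M a x := by
  rw [trigPoly, map_sum]
  refine Finset.sum_nbij' (fun k => -k) (fun k => -k) ?_ ?_ ?_ ?_ ?_
  · intro k hk
    simp only [Finset.mem_Icc] at hk ⊢; omega
  · intro k hk
    simp only [Finset.mem_Icc] at hk ⊢; omega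
  · simp
  · simp
  · intro k _
    rw [map_mul, ← ha, ← Complex.exp_conj]
    simp

theorem trigPoly_mul {N M : ℕ} (hNM : 2 * N ≤ M) {a b : ℤ → ℂ}
    (ha : ∀ k, k ∉ Finset.Icc (-(N : ℤ)) N → a k = 0)
    (hb : ∀ k, k ∉ Finset.Icc (-(N : ℤ)) N → b k = 0) (x : ℝ) :
    trigPoly M a x * trigPoly M b x = trigPoly M (seqConv a b) x := by
  have hconv : ∀ k, seqConv a b k = ∑ j ∈ Finset.Icc (-(M : ℤ)) M, a j * b (k - j) := by
    refine fun k => tsum_eq_sum fun j hj => ?_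
    rw [ha j (by simp only [Finset.mem_Icc] at hj ⊢; omega), zero_mul]
  simp only [trigPoly, hconv, Finset.sum_mul]
  rw [Finset.sum_comm]
  refine Finset.sum_congr rfl fun j _ => ?_
  by_cases hj : j ∈ Finset.Icc (-(N : ℤ)) N
  · set f : ℤ → ℂ := fun l => b l * cexp (l * x * I) with hf
    have hf0 : ∀ l, l ∉ Finset.Icc (-(N : ℤ)) N → f l = 0 := fun l hl => by simp [hf, hb l hl]
    have h1 : ∑ l ∈ Finset.Icc (-(M : ℤ)) M, f l = ∑' l, f l :=
      (tsum_eq_sum fun l hl => hf0 l (by simp only [Finset.mem_Icc] at hl ⊢; omega)).symm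
    have h2 : ∑ k ∈ Finset.Icc (-(M : ℤ)) M, f (k - j) = ∑' l, f l := by
      rw [← (Equiv.subRight j).tsum_eq f]
      exact (tsum_eq_sum fun l hl => hf0 _ (by
        simp only [Finset.mem_Icc] at hl hj ⊢; omega)).symm
    change _ * ∑ l ∈ Finset.Icc (-(M : ℤ)) M, f l = _
    rw [h1, ← h2, Finset.mul_sum]
    refine Finset.sum_congr rfl fun k _ => ?_
    have h3 : cexp (k * x * I) = cexp (j * x * I) * cexp (((k - j : ℤ) : ℂ) * x * I) := by
      rw [← Complex.exp_add]
      push_cast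
      ring_nf
    rw [hf, h3]
    ring
  · simp [ha j hj]

/-- The real part of a trigonometric polynomial. -/
noncomputable def realTrigPoly (M : ℕ) (a : ℤ → ℂ) (x : ℝ) : ℝ := (trigPoly M a x).re

theorem ofReal_realTrigPoly (M : ℕ) {a : ℤ → ℂ} (ha : IsRealSeq a) (x : ℝ) :
    (realTrigPoly M a x : ℂ) = trigPoly M a x :=
  Complex.conj_eq_iff_re.1 (conj_trigPoly M ha x)

theorem hasDerivAt_realTrigPoly (M : ℕ) (a : ℤ → ℂ) (x : ℝ) :
    HasDerivAt (realTrigPoly M a) (realTrigPoly M (fun k => I * k * a k) x) x :=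
  Complex.reCLM.hasFDerivAt.comp_hasDerivAt x (hasDerivAt_trigPoly M a x)

theorem continuous_realTrigPoly (M : ℕ) (a : ℤ → ℂ) : Continuous (realTrigPoly M a) :=
  continuous_iff_continuousAt.2 fun x => (hasDerivAt_realTrigPoly M a x).continuousAt

theorem realTrigPoly_two_pi (M : ℕ) (a : ℤ → ℂ) :
    realTrigPoly M a (2 * π) = realTrigPoly M a 0 := by
  rw [realTrigPoly, trigPoly_two_pi, realTrigPoly]

theorem realTrigPoly_sub (M : ℕ) (a b : ℤ → ℂ) (x : ℝ) :
    realTrigPoly M (fun k => a k - b k) x = realTrigPoly M a x - realTrigPoly M b x := by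
  rw [realTrigPoly, trigPoly_sub, Complex.sub_re, realTrigPoly, realTrigPoly]

theorem integral_realTrigPoly (M : ℕ) (a : ℤ → ℂ) :
    ∫ x in (0 : ℝ)..(2 * π), realTrigPoly M a x = 2 * π * (a 0).re := by
  have h1 : IntervalIntegrable (trigPoly M a) volume 0 (2 * π) :=
    (continuous_iff_continuousAt.2 fun x =>
      (hasDerivAt_trigPoly M a x).continuousAt).intervalIntegrable _ _
  have h2 := Complex.reCLM.intervalIntegral_comp_comm h1
  rw [integral_trigPoly] at h2
  simpa [realTrigPoly] using h2

theorem realTrigPoly_mul {N M : ℕ} (hNM : 2 * N ≤ M) {a b : ℤ → ℂ}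
    (har : IsRealSeq a) (hbr : IsRealSeq b)
    (ha : ∀ k, k ∉ Finset.Icc (-(N : ℤ)) N → a k = 0)
    (hb : ∀ k, k ∉ Finset.Icc (-(N : ℤ)) N → b k = 0) (x : ℝ) :
    realTrigPoly M a x * realTrigPoly M b x = realTrigPoly M (seqConv a b) x := by
  have h := trigPoly_mul hNM ha hb x
  rw [← ofReal_realTrigPoly M har, ← ofReal_realTrigPoly M hbr,
    ← ofReal_realTrigPoly M (har.seqConv hbr)] at h
  exact_mod_cast h

theorem seqConv_self_zero {a : ℤ → ℂ} (ha : IsRealSeq a) :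
    seqConv a a 0 = ((∑' k, ‖a k‖ ^ 2 : ℝ) : ℂ) := by
  rw [seqConv, Complex.ofReal_tsum]
  refine tsum_congr fun k => ?_
  rw [zero_sub, ha k, Complex.mul_conj, Complex.normSq_eq_norm_sq]

theorem integral_realTrigPoly_sq {N M : ℕ} (hNM : 2 * N ≤ M) {a : ℤ → ℂ}
    (har : IsRealSeq a) (ha : ∀ k, k ∉ Finset.Icc (-(N : ℤ)) N → a k = 0) :
    ∫ x in (0 : ℝ)..(2 * π), realTrigPoly M a x ^ 2 = 2 * π * ∑' k, ‖a k‖ ^ 2 := by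
  simp only [sq (realTrigPoly _ _ _), realTrigPoly_mul hNM har har ha ha]
  rw [integral_realTrigPoly, seqConv_self_zero har, Complex.ofReal_re]

theorem seqConv_eq_zero_of_notMem {N : ℕ} {a b : ℤ → ℂ}
    (ha : ∀ k, k ∉ Finset.Icc (-(N : ℤ)) N → a k = 0)
    (hb : ∀ k, k ∉ Finset.Icc (-(N : ℤ)) N → b k = 0) (k : ℤ)
    (hk : k ∉ Finset.Icc (-((2 * N : ℕ) : ℤ)) (2 * N : ℕ)) : seqConv a b k = 0 := by
  refine (tsum_congr fun j => ?_).trans tsum_zero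
  by_cases hj : j ∈ Finset.Icc (-(N : ℤ)) N
  · rw [hb _ (by simp only [Finset.mem_Icc] at hk hj ⊢; push_cast at hk; omega), mul_zero]
  · rw [ha j hj, zero_mul]

namespace MeanZeroReal

variable {N : ℕ} {q w : MeanZeroReal}

theorem coeff_add_invConv_eq_zero (hq : ∀ k, k ∉ Finset.Icc (-(N : ℤ)) N → q.coeff k = 0)
    (hw : ∀ k, k ∉ Finset.Icc (-(N : ℤ)) N → w.coeff k = 0) (k : ℤ)
    (hk : k ∉ Finset.Icc (-((2 * N : ℕ) : ℤ)) (2 * N : ℕ)) :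
    (w + invConv q w).coeff k = 0 := by
  rw [coeff_add, coeff_invConv, antideriv, seqConv_eq_zero_of_notMem hq hw k hk,
    hw k (by simp only [Finset.mem_Icc] at hk ⊢; push_cast at hk; omega)]
  simp

theorem hasDerivAt_realTrigPoly_sub {M : ℕ} (hNM : 2 * N ≤ M)
    (hq : ∀ k, k ∉ Finset.Icc (-(N : ℤ)) N → q.coeff k = 0)
    (hw : ∀ k, k ∉ Finset.Icc (-(N : ℤ)) N → w.coeff k = 0) (x : ℝ) :
    HasDerivAt (fun x => realTrigPoly M w.coeff x - realTrigPoly M (w + invConv q w).coeff x)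
      ((seqConv q.coeff w.coeff 0).re -
        realTrigPoly M q.coeff x * realTrigPoly M w.coeff x) x := by
  have h1 := hasDerivAt_realTrigPoly M (fun k => w.coeff k - (w + invConv q w).coeff k) x
  have h2 : (fun k : ℤ => I * k * (w.coeff k - (w + invConv q w).coeff k)) =
      fun k => (if k = 0 then seqConv q.coeff w.coeff 0 else 0) - seqConv q.coeff w.coeff k := by
    funext k
    rw [coeff_add, coeff_invConv, antideriv]
    split_ifs with hk
    · simp [hk]
    · have hk' : (k : ℂ) ≠ 0 := by exact_mod_cast hk
      field_simp
      ring
  rw [h2, realTrigPoly_sub, ← realTrigPoly_mul hNM q.isRealSeq_coeff w.isRealSeq_coeff hq hw] at h1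
  rw [realTrigPoly, trigPoly_ite] at h1
  exact h1.congr_of_eventuallyEq (.of_forall fun x => (realTrigPoly_sub M _ _ x).symm)

theorem integral_realTrigPoly_coeff (M : ℕ) (x : MeanZeroReal) :
    ∫ t in (0 : ℝ)..(2 * π), realTrigPoly M x.coeff t = 0 := by
  rw [integral_realTrigPoly, coeff_zero]
  simp

/-- The constant in the linear estimate for the operator `1 + invConv q` on `‖q‖ ≤ R`. -/
noncomputable def linearConst (R : ℝ) : ℝ :=
  4 * π * (rexp (2 * (π + 2 * π * R ^ 2)) * (rexp (2 * (π + 2 * π * R ^ 2)) + 1)) ^ 2 *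
    (2 * π * R ^ 2) + 2

theorem norm_sq_le_of_finite_support {R : ℝ} (hR : ‖q‖ ≤ R)
    (hq : ∀ k, k ∉ Finset.Icc (-(N : ℤ)) N → q.coeff k = 0)
    (hw : ∀ k, k ∉ Finset.Icc (-(N : ℤ)) N → w.coeff k = 0) :
    ‖w‖ ^ 2 ≤ linearConst R * ‖w + invConv q w‖ ^ 2 := by
  have hK : ∫ x in (0 : ℝ)..(2 * π), realTrigPoly (4 * N) q.coeff x ^ 2 ≤ 2 * π * R ^ 2 := by
    rw [integral_realTrigPoly_sq (by omega) q.isRealSeq_coeff hq, ← norm_sq_eq]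
    gcongr
  have h := integral_sq_le_of_linear (continuous_realTrigPoly (4 * N) q.coeff)
    (continuous_realTrigPoly (4 * N) w.coeff)
    (continuous_realTrigPoly (4 * N) (w + invConv q w).coeff)
    (hasDerivAt_realTrigPoly_sub (by omega) hq hw) (by simp only [realTrigPoly_two_pi])
    (by
      rw [intervalIntegral.integral_sub
        ((continuous_realTrigPoly _ _).intervalIntegrable _ _)
        ((continuous_realTrigPoly _ _).intervalIntegrable _ _),
        integral_realTrigPoly_coeff, integral_realTrigPoly_coeff, sub_zero])
    (integral_realTrigPoly_coeff _ _) hK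
  rw [integral_realTrigPoly_sq (by omega) w.isRealSeq_coeff hw,
    integral_realTrigPoly_sq (N := 2 * N) (by omega) (isRealSeq_coeff _)
      (coeff_add_invConv_eq_zero hq hw), ← norm_sq_eq, ← norm_sq_eq] at h
  change _ ≤ linearConst R * _ at h
  have hpi := Real.pi_pos
  refine le_of_mul_le_mul_left ?_ (by positivity : 0 < 2 * π)
  linarith

theorem norm_sq_le_of_quadratic_of_finite_support {R : ℝ} (hR : ‖w + invConv w w‖ ≤ R)
    (hw : ∀ k, k ∉ Finset.Icc (-(N : ℤ)) N → w.coeff k = 0) :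
    ‖w‖ ^ 2 ≤ 2 * (2 * π * R ^ 2) * (4 * (2 * π * R ^ 2) + 5) := by
  have hK : ∫ x in (0 : ℝ)..(2 * π), realTrigPoly (4 * N) (w + invConv w w).coeff x ^ 2 ≤
      2 * π * R ^ 2 := by
    rw [integral_realTrigPoly_sq (N := 2 * N) (by omega) (isRealSeq_coeff _)
      (coeff_add_invConv_eq_zero hw hw), ← norm_sq_eq]
    gcongr
  have hd : ∀ x, HasDerivAt (fun x => realTrigPoly (4 * N) w.coeff x -
      realTrigPoly (4 * N) (w + invConv w w).coeff x)
      (‖w‖ ^ 2 - realTrigPoly (4 * N) w.coeff x ^ 2) x := fun x => by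
    have := hasDerivAt_realTrigPoly_sub (M := 4 * N) (by omega) hw hw x
    rwa [seqConv_self_zero w.isRealSeq_coeff, Complex.ofReal_re, ← norm_sq_eq, ← sq] at this
  exact riccati_const_le (continuous_realTrigPoly _ _) (continuous_realTrigPoly _ _) hd
    (by simp only [realTrigPoly_two_pi]) (integral_realTrigPoly_coeff _ _) hK

end MeanZeroReal

end TrigPolynomials

section MiuraOnMeanZero

open Topology Filter

namespace MeanZeroReal

theorem tendsto_trunc_add_invConv (q w : MeanZeroReal) :
    Tendsto (fun N => trunc N w + invConv (trunc N q) (trunc N w)) atTop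
      (𝓝 (w + invConv q w)) := by
  have h1 := (invConv.continuous₂.tendsto (q, w)).comp
    ((tendsto_trunc q).prodMk_nhds (tendsto_trunc w))
  exact (tendsto_trunc w).add h1

theorem exists_norm_le_mul_norm_add_invConv (R : ℝ) :
    ∃ C : ℝ, 0 < C ∧ ∀ q w : MeanZeroReal, ‖q‖ ≤ R → ‖w‖ ≤ C * ‖w + invConv q w‖ := by
  have hL : 0 < linearConst (R + 1) := by unfold linearConst; positivity
  refine ⟨√(linearConst (R + 1)), by positivity, fun q w hq => ?_⟩
  have hlim : Tendsto (fun N => √(linearConst (R + 1)) *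
      ‖trunc N w + invConv (trunc N q) (trunc N w)‖) atTop
      (𝓝 (√(linearConst (R + 1)) * ‖w + invConv q w‖)) :=
    (tendsto_trunc_add_invConv q w).norm.const_mul _
  refine le_of_tendsto_of_tendsto (tendsto_trunc w).norm hlim ?_
  filter_upwards [(tendsto_trunc q).norm.eventually_le_const (by linarith : ‖q‖ < R + 1)] with N hN
  refine (sq_le_sq₀ (norm_nonneg _) (by positivity)).1 ?_
  rw [mul_pow, Real.sq_sqrt hL.le]
  exact norm_sq_le_of_finite_support hN (fun _ => coeff_trunc_eq_zero)
    (fun _ => coeff_trunc_eq_zero)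

theorem exists_norm_le_of_norm_add_invConv_le (R : ℝ) :
    ∃ F : ℝ, ∀ v : MeanZeroReal, ‖v + invConv v v‖ ≤ R → ‖v‖ ≤ F := by
  refine ⟨√(2 * (2 * Real.pi * (R + 1) ^ 2) * (4 * (2 * Real.pi * (R + 1) ^ 2) + 5)),
    fun v hv => ?_⟩
  refine le_of_tendsto (tendsto_trunc v).norm ?_
  filter_upwards [(tendsto_trunc_add_invConv v v).norm.eventually_le_const
    (by linarith : ‖v + invConv v v‖ < R + 1)] with N hN
  exact Real.le_sqrt_of_sq_le
    (norm_sq_le_of_quadratic_of_finite_support hN (fun _ => coeff_trunc_eq_zero))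

theorem bijective_add_invConv :
    Function.Bijective fun v : MeanZeroReal => v + invConv v v := by
  refine ⟨fun x y hxy => ?_, quadratic_surjective invConv invConv_comm
    exists_norm_le_mul_norm_add_invConv exists_norm_le_of_norm_add_invConv_le⟩
  obtain ⟨C, -, hb⟩ := exists_norm_le_mul_norm_add_invConv ‖x + y‖
  have h := hb (x + y) (x - y) le_rfl
  rw [← quadratic_sub invConv invConv_comm, sub_eq_zero.2 hxy, norm_zero, mul_zero] at h
  exact sub_eq_zero.1 (norm_le_zero_iff.1 h)

end MeanZeroReal

end MiuraOnMeanZero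

section Bootstrapping

namespace MeanZeroReal

theorem coeff_eq_sub (q w : MeanZeroReal) :
    w.coeff = fun k => (w + invConv q w).coeff k - (invConv q w).coeff k := by
  funext k
  rw [coeff_add, add_sub_cancel_right]

theorem exists_hsNorm_le_of_add_invConv_aux (n : ℕ) :
    ∀ s : ℝ, 0 ≤ s → s ≤ n / 3 → ∀ R : ℝ, ∃ F : ℝ, ∀ v : MeanZeroReal,
      InHs s (v + invConv v v).coeff → hsNorm s (v + invConv v v).coeff ≤ R →
        InHs s v.coeff ∧ hsNorm s v.coeff ≤ F := by
  induction n with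
  | zero =>
    intro s h0 hs R
    obtain rfl : s = 0 := le_antisymm (by simpa using hs) h0
    obtain ⟨F, hF⟩ := exists_norm_le_of_norm_add_invConv_le R
    refine ⟨F, fun v _ hv => ⟨v.inHs_coeff, ?_⟩⟩
    rw [← norm_eq] at hv ⊢
    exact hF v hv
  | succ n ih =>
    intro s h0 hs R
    push_cast at hs
    set t : ℝ := max 0 (s - 1 / 3) with ht
    have ht0 : 0 ≤ t := le_max_left _ _
    have hts : t ≤ s := max_le h0 (by linarith)
    have hst : s ≤ t + 1 / 3 := by linarith [le_max_right 0 (s - 1 / 3)]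
    obtain ⟨F, hF⟩ := ih t ht0 (max_le (by positivity) (by linarith)) R
    obtain ⟨C, hC, hb⟩ := exists_hsNorm_antideriv_seqConv_le ht0
    refine ⟨2 * (R + C * (F * F)), fun v hv hvR => ?_⟩
    obtain ⟨h1, h2⟩ := hv.mono hts
    obtain ⟨h3, h4⟩ := hF v h1 (h2.trans hvR)
    obtain ⟨h5, h6⟩ := hb _ _ h3 h3
    obtain ⟨h7, h8⟩ := h5.mono hst
    rw [coeff_eq_sub v v]
    obtain ⟨h9, h10⟩ := hv.sub h7
    refine ⟨h9, h10.trans ?_⟩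
    have hn := hsNorm_nonneg t v.coeff
    have : hsNorm t v.coeff * hsNorm t v.coeff ≤ F * F :=
      mul_le_mul h4 h4 hn (hn.trans h4)
    have := mul_le_mul_of_nonneg_left this hC
    linarith

theorem exists_hsNorm_le_of_add_invConv {s : ℝ} (hs : 0 ≤ s) (R : ℝ) :
    ∃ F : ℝ, ∀ v : MeanZeroReal, InHs s (v + invConv v v).coeff →
      hsNorm s (v + invConv v v).coeff ≤ R → InHs s v.coeff ∧ hsNorm s v.coeff ≤ F := by
  obtain ⟨n, hn⟩ := exists_nat_ge (s * 3)
  exact exists_hsNorm_le_of_add_invConv_aux n s hs (by linarith) R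

theorem exists_hsNorm_le_mul_hsNorm_add_invConv_aux (n : ℕ) :
    ∀ s : ℝ, 0 ≤ s → s ≤ n / 3 → ∀ R : ℝ, ∃ C : ℝ, 0 < C ∧ ∀ q w : MeanZeroReal,
      InHs s q.coeff → hsNorm s q.coeff ≤ R → InHs s (w + invConv q w).coeff →
        InHs s w.coeff ∧ hsNorm s w.coeff ≤ C * hsNorm s (w + invConv q w).coeff := by
  induction n with
  | zero =>
    intro s h0 hs R
    obtain rfl : s = 0 := le_antisymm (by simpa using hs) h0
    obtain ⟨C, hC, hb⟩ := exists_norm_le_mul_norm_add_invConv R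
    refine ⟨C, hC, fun q w _ hq _ => ⟨w.inHs_coeff, ?_⟩⟩
    rw [← norm_eq] at hq ⊢
    rw [← norm_eq]
    exact hb q w hq
  | succ n ih =>
    intro s h0 hs R
    push_cast at hs
    set t : ℝ := max 0 (s - 1 / 3) with ht
    have ht0 : 0 ≤ t := le_max_left _ _
    have hts : t ≤ s := max_le h0 (by linarith)
    have hst : s ≤ t + 1 / 3 := by linarith [le_max_right 0 (s - 1 / 3)]
    obtain ⟨F, hF, hw⟩ := ih t ht0 (max_le (by positivity) (by linarith)) R
    obtain ⟨C, hC, hb⟩ := exists_hsNorm_antideriv_seqConv_le ht0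
    refine ⟨2 * (1 + C * (|R| * F)), by positivity, fun q w hq hqR hv => ?_⟩
    obtain ⟨h1, h2⟩ := hv.mono hts
    obtain ⟨hq1, hq2⟩ := hq.mono hts
    obtain ⟨h3, h4⟩ := hw q w hq1 (hq2.trans hqR) h1
    obtain ⟨h5, h6⟩ := hb _ _ hq1 h3
    obtain ⟨h7, h8⟩ := h5.mono hst
    obtain ⟨h9, h10⟩ := hv.sub h7
    rw [← coeff_invConv, ← coeff_eq_sub] at h9 h10
    refine ⟨h9, h10.trans ?_⟩
    have hn := hsNorm_nonneg t w.coeff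
    have hqR' : hsNorm t q.coeff ≤ |R| := (hq2.trans hqR).trans (le_abs_self R)
    have : hsNorm t q.coeff * hsNorm t w.coeff ≤
        |R| * (F * hsNorm s (w + invConv q w).coeff) := by
      refine mul_le_mul hqR' (h4.trans ?_) hn (abs_nonneg R)
      gcongr
    have := mul_le_mul_of_nonneg_left this hC
    rw [coeff_invConv]
    linarith

theorem exists_hsNorm_le_mul_hsNorm_add_invConv {s : ℝ} (hs : 0 ≤ s) (R : ℝ) :
    ∃ C : ℝ, 0 < C ∧ ∀ q w : MeanZeroReal,
      InHs s q.coeff → hsNorm s q.coeff ≤ R → InHs s (w + invConv q w).coeff →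
        InHs s w.coeff ∧ hsNorm s w.coeff ≤ C * hsNorm s (w + invConv q w).coeff := by
  obtain ⟨n, hn⟩ := exists_nat_ge (s * 3)
  exact exists_hsNorm_le_mul_hsNorm_add_invConv_aux n s hs (by linarith) R

end MeanZeroReal

end Bootstrapping

section MiuraMap

open Complex MeanZeroReal

theorem InHs.antideriv {s : ℝ} {u : ℤ → ℂ} (hu : InHs (s - 1) u) :
    InHs s (antideriv u) ∧ hsNorm s (antideriv u) ≤ 2 * hsNorm (s - 1) u := by
  refine hsNorm_le_of_le (by positivity [hsNorm_nonneg (s - 1) u]) (hu.mul_left 4)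
    (fun k => ?_) ?_
  · rcases eq_or_ne k 0 with rfl | hk
    · simp
    have hk1 : (1 : ℝ) ≤ (k : ℝ) ^ 2 := by
      have : (1 : ℤ) ≤ k ^ 2 := by have := sq_pos_of_ne_zero hk; omega
      exact_mod_cast this
    have h3 : ‖_root_.antideriv u k‖ ^ 2 = ((k : ℝ) ^ 2)⁻¹ * ‖u k‖ ^ 2 := by
      rw [_root_.antideriv, norm_mul, mul_pow, norm_inv, norm_mul, Complex.norm_I, one_mul,
        Complex.norm_intCast, inv_pow, sq_abs]
    have h4 : (1 + (k : ℝ) ^ 2) * ((k : ℝ) ^ 2)⁻¹ ≤ 4 := by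
      rw [← div_eq_mul_inv, div_le_iff₀ (by linarith)]
      linarith
    have h5 : (1 + (k : ℝ) ^ 2) ^ s = (1 + (k : ℝ) ^ 2) ^ (s - 1) * (1 + (k : ℝ) ^ 2) := by
      rw [← Real.rpow_add_one (one_add_sq_pos k).ne', sub_add_cancel]
    calc (1 + (k : ℝ) ^ 2) ^ s * ‖_root_.antideriv u k‖ ^ 2
        = ((1 + (k : ℝ) ^ 2) * ((k : ℝ) ^ 2)⁻¹) *
            ((1 + (k : ℝ) ^ 2) ^ (s - 1) * ‖u k‖ ^ 2) := by rw [h3, h5]; ring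
      _ ≤ _ := by gcongr
  · rw [tsum_mul_left, ← hsNorm_sq]
    linarith

theorem miura_eq_iff {v u : ℤ → ℂ} (hv : v 0 = 0) (hu : u 0 = 0) :
    miura v = u ↔ ∀ k, v k + antideriv (seqConv v v) k = antideriv u k := by
  rw [funext_iff]
  refine forall_congr' fun k => ?_
  by_cases hk : k = 0
  · subst hk
    simp [miura, hv, hu]
  · have hk' : (k : ℂ) ≠ 0 := by exact_mod_cast hk
    have hI : I * (k : ℂ) ≠ 0 := mul_ne_zero I_ne_zero hk'
    rw [miura, if_neg hk, antideriv, antideriv, ← mul_right_inj' (inv_ne_zero hI), mul_add,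
      inv_mul_cancel_left₀ hI]

theorem coeff_mk_add_invConv {v u : ℤ → ℂ} (h0 : v 0 = 0) (hr : IsRealSeq v) (hv : InHs 0 v)
    (hu : u 0 = 0) (h : miura v = u) :
    (mk v h0 hr hv + invConv (mk v h0 hr hv) (mk v h0 hr hv)).coeff = antideriv u :=
  funext ((miura_eq_iff h0 hu).1 h)

theorem existsUnique_miura_eq {s : ℝ} (hs : 0 ≤ s) {u : ℤ → ℂ} (hur : IsRealSeq u)
    (hu0 : u 0 = 0) (hu : InHs (s - 1) u) :
    ∃! v : ℤ → ℂ, IsRealSeq v ∧ v 0 = 0 ∧ InHs s v ∧ miura v = u := by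
  obtain ⟨hU, -⟩ := hu.antideriv
  set U : MeanZeroReal := mk (antideriv u) (antideriv_zero u) hur.antideriv (hU.mono hs).1
  obtain ⟨x, hx : x + invConv x x = U⟩ := bijective_add_invConv.2 U
  refine ⟨x.coeff, ⟨x.isRealSeq_coeff, x.coeff_zero, ?_, ?_⟩, ?_⟩
  · obtain ⟨F, hF⟩ := exists_hsNorm_le_of_add_invConv hs (hsNorm s U.coeff)
    exact (hF x (hx ▸ hU) (hx ▸ le_rfl)).1
  · refine (miura_eq_iff x.coeff_zero hu0).2 fun k => ?_
    exact congrFun (congrArg coeff hx) k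
  · rintro v ⟨hvr, hv0, hv, hvu⟩
    have h := coeff_mk_add_invConv hv0 hvr (hv.mono hs).1 hu0 hvu
    have hvx : mk v hv0 hvr (hv.mono hs).1 = x := by
      refine bijective_add_invConv.1 (MeanZeroReal.ext fun k => ?_)
      change (mk v hv0 hvr _ + invConv (mk v hv0 hvr _) (mk v hv0 hvr _)).coeff k =
        (x + invConv x x).coeff k
      rw [h, hx]
      rfl
    exact congrArg coeff hvx

theorem exists_hsNorm_sub_le_of_miura {s : ℝ} (hs : 0 ≤ s) (R : ℝ) :
    ∃ K : ℝ, 0 < K ∧ ∀ u₁ u₂ v₁ v₂ : ℤ → ℂ,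
      u₁ 0 = 0 → InHs (s - 1) u₁ → hsNorm (s - 1) u₁ ≤ R →
      u₂ 0 = 0 → InHs (s - 1) u₂ → hsNorm (s - 1) u₂ ≤ R →
      IsRealSeq v₁ → v₁ 0 = 0 → InHs s v₁ → miura v₁ = u₁ →
      IsRealSeq v₂ → v₂ 0 = 0 → InHs s v₂ → miura v₂ = u₂ →
      hsNorm s (fun k => v₁ k - v₂ k) ≤ K * hsNorm (s - 1) (fun k => u₁ k - u₂ k) := by
  obtain ⟨F, hF⟩ := exists_hsNorm_le_of_add_invConv hs (2 * R)
  obtain ⟨C, hC, hb⟩ := exists_hsNorm_le_mul_hsNorm_add_invConv hs (2 * (F + F))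
  refine ⟨2 * C, by positivity, ?_⟩
  intro u₁ u₂ v₁ v₂ hu₁0 hu₁ hu₁R hu₂0 hu₂ hu₂R hv₁r hv₁0 hv₁ hm₁ hv₂r hv₂0 hv₂ hm₂
  have h₁ := coeff_mk_add_invConv hv₁0 hv₁r (hv₁.mono hs).1 hu₁0 hm₁
  have h₂ := coeff_mk_add_invConv hv₂0 hv₂r (hv₂.mono hs).1 hu₂0 hm₂
  set x : MeanZeroReal := mk v₁ hv₁0 hv₁r (hv₁.mono hs).1
  set y : MeanZeroReal := mk v₂ hv₂0 hv₂r (hv₂.mono hs).1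
  have hx := (hF x (h₁ ▸ hu₁.antideriv.1) (h₁ ▸ hu₁.antideriv.2.trans (by linarith))).2
  have hy := (hF y (h₂ ▸ hu₂.antideriv.1) (h₂ ▸ hu₂.antideriv.2.trans (by linarith))).2
  obtain ⟨hq, hqR⟩ := hv₁.add hv₂
  obtain ⟨hu, -⟩ := hu₁.sub hu₂
  have hH : ((x - y) + invConv (x + y) (x - y)).coeff = antideriv (fun k => u₁ k - u₂ k) := by
    rw [← quadratic_sub invConv invConv_comm]
    funext k
    rw [coeff_sub, h₁, h₂, antideriv, antideriv, antideriv, mul_sub]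
  have hqF : hsNorm s (x + y).coeff ≤ 2 * (F + F) := by
    refine hqR.trans ?_
    have hx' : hsNorm s v₁ ≤ F := hx
    have hy' : hsNorm s v₂ ≤ F := hy
    linarith
  have h := (hb (x + y) (x - y) hq hqF (hH ▸ hu.antideriv.1)).2
  rw [hH] at h
  calc hsNorm s (fun k => v₁ k - v₂ k)
      ≤ C * hsNorm s (antideriv fun k => u₁ k - u₂ k) := h
    _ ≤ C * (2 * hsNorm (s - 1) (fun k => u₁ k - u₂ k)) :=
        mul_le_mul_of_nonneg_left hu.antideriv.2 hC.le
    _ = _ := by ring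

end MiuraMap

/-- Theorem 2.1: for `s ≥ 1/2` the Miura map is a bijection from `H^s₀(𝕋)` onto
`H^{s-1}₀(𝕋)`, and its inverse is locally Lipschitz from `H^{s-1}₀(𝕋)` to `H^s₀(𝕋)`. -/
theorem miura_bijective_with_locally_lipschitz_inverse (s : ℝ) (hs : 1 / 2 ≤ s) :
    (∀ u : ℤ → ℂ, IsRealSeq u → u 0 = 0 → InHs (s - 1) u →
      ∃! v : ℤ → ℂ, IsRealSeq v ∧ v 0 = 0 ∧ InHs s v ∧ miura v = u) ∧
    (∀ R : ℝ, 0 < R → ∃ K : ℝ, 0 < K ∧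
      ∀ u₁ u₂ v₁ v₂ : ℤ → ℂ,
        IsRealSeq u₁ → u₁ 0 = 0 → InHs (s - 1) u₁ → hsNorm (s - 1) u₁ ≤ R →
        IsRealSeq u₂ → u₂ 0 = 0 → InHs (s - 1) u₂ → hsNorm (s - 1) u₂ ≤ R →
        IsRealSeq v₁ → v₁ 0 = 0 → InHs s v₁ → miura v₁ = u₁ →
        IsRealSeq v₂ → v₂ 0 = 0 → InHs s v₂ → miura v₂ = u₂ →
        hsNorm s (fun k => v₁ k - v₂ k) ≤ K * hsNorm (s - 1) (fun k => u₁ k - u₂ k)) := by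
  have hs0 : 0 ≤ s := by linarith
  refine ⟨fun u hur hu0 hu => existsUnique_miura_eq hs0 hur hu0 hu, fun R _ => ?_⟩
  obtain ⟨K, hK, hb⟩ := exists_hsNorm_sub_le_of_miura hs0 R
  refine ⟨K, hK, ?_⟩
  intro u₁ u₂ v₁ v₂ _ hu₁0 hu₁ hu₁R _ hu₂0 hu₂ hu₂R
  exact hb u₁ u₂ v₁ v₂ hu₁0 hu₁ hu₁R hu₂0 hu₂ hu₂R
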